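/- Let d ∈ ℕ. Then there exists an MLP f with input dimension d and hidden dimension 6d such that for all x ∈ ℝ^d, the vector y = x + f(x) satisfies, for each coordinate i: y_i = −1 if x_i ∈ [−5/4, −3/4], y_i = 0 if x_i ∈ [−1/4, 1/4], and y_i = 1 if x_i ∈ [3/4, 5/4]. Moreover, for b_m ≥ 1 and b_e ≥ 3, this same f has the property that for inputs x ∈ (F_{b_m,b_e})^d the conclusion still holds when the hidden activations ReLU(W₁x + b), the output f(x), and the sum x + f(x) are each rounded coordinatewise to F_{b_m,b_e} (in fact all of these quantities already lie in F_{b_m,b_e}, so rounding has no effect). -/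

import Mathlib

/-- A single-hidden-layer ReLU MLP `x ↦ W₂ ReLU(W₁ x + b)` with input/output dimension `d`
and hidden dimension `dff`. -/
structure MLP (d dff : ℕ) where
  W1 : Matrix (Fin dff) (Fin d) ℝ
  b : Fin dff → ℝ
  W2 : Matrix (Fin d) (Fin dff) ℝ

/-- The hidden activations `ReLU(W₁ x + b)` of the MLP. -/
noncomputable def MLP.hidden {d dff : ℕ} (f : MLP d dff) (x : Fin d → ℝ) : Fin dff → ℝ :=
  fun h => max 0 (f.W1.mulVec x h + f.b h)

/-- The output `W₂ ReLU(W₁ x + b)` of the MLP. -/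
noncomputable def MLP.eval {d dff : ℕ} (f : MLP d dff) (x : Fin d → ℝ) : Fin d → ℝ :=
  f.W2.mulVec (f.hidden x)

/-- The MLP has ternary weights: all entries of `W₁` and `W₂` lie in `{-1,0,1}`. -/
def MLP.Ternary {d dff : ℕ} (f : MLP d dff) : Prop :=
  (∀ i j, f.W1 i j = -1 ∨ f.W1 i j = 0 ∨ f.W1 i j = 1) ∧
  (∀ i j, f.W2 i j = -1 ∨ f.W2 i j = 0 ∨ f.W2 i j = 1)

def IsTernary (a : ℝ) : Prop := a = -1 ∨ a = 0 ∨ a = 1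
def IsBit (a : ℝ) : Prop := a = 0 ∨ a = 1
def IsSign (a : ℝ) : Prop := a = -1 ∨ a = 1

/-- Smallest exponent of the floating-point format with `be` exponent bits. -/
def Emin (be : ℕ) : ℤ := 2 - 2 ^ (be - 1)

/-- Largest exponent of the floating-point format with `be` exponent bits. -/
def Emax (be : ℕ) : ℤ := 2 ^ (be - 1) - 1

/-- The set of floating-point numbers with `bm` mantissa bits and `be` exponent bits. -/
def floatSet (bm be : ℕ) : Set ℝ :=
  {x | ∃ (ε : ℝ) (t : ℕ) (κ : ℤ), (ε = 1 ∨ ε = -1) ∧ t < 2 ^ bm ∧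
      Emin be ≤ κ ∧ κ ≤ Emax be ∧
      x = ε * (1 + (t : ℝ) * (2 : ℝ) ^ (-(bm : ℤ))) * (2 : ℝ) ^ κ} ∪
  {x | ∃ (ε : ℝ) (t : ℕ), (ε = 1 ∨ ε = -1) ∧ t < 2 ^ bm ∧
      x = ε * ((t : ℝ) * (2 : ℝ) ^ (-(bm : ℤ))) * (2 : ℝ) ^ (Emin be)}

/-- `y` is a rounding of `x` to the set `F` if `y ∈ F` minimizes the distance to `x`. -/
def IsRounding (F : Set ℝ) (x y : ℝ) : Prop :=
  y ∈ F ∧ ∀ z ∈ F, |x - y| ≤ |x - z|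

lemma IsRounding.eq_of_mem {F : Set ℝ} {x y : ℝ} (h : IsRounding F x y) (hx : x ∈ F) : y = x := by
  have := h.2 x hx
  rw [sub_self, abs_zero] at this
  linarith [abs_eq_zero.1 (le_antisymm this (abs_nonneg _))]

lemma neg_mem_floatSet {bm be : ℕ} {x : ℝ} (hx : x ∈ floatSet bm be) : -x ∈ floatSet bm be := by
  have hneg : ∀ ε : ℝ, ε = 1 ∨ ε = -1 → -ε = 1 ∨ -ε = -1 := by
    rintro ε (rfl | rfl) <;> simp
  rcases hx with ⟨ε, t, κ, hε, ht, h₁, h₂, rfl⟩ | ⟨ε, t, hε, ht, rfl⟩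
  · exact Or.inl ⟨-ε, t, κ, hneg ε hε, ht, h₁, h₂, by ring⟩
  · exact Or.inr ⟨-ε, t, hneg ε hε, ht, by ring⟩

lemma zero_mem_floatSet (bm be : ℕ) : (0 : ℝ) ∈ floatSet bm be :=
  Or.inr ⟨1, 0, Or.inl rfl, by positivity, by simp⟩

lemma max_zero_mem_floatSet {bm be : ℕ} {x : ℝ} (hx : x ∈ floatSet bm be) :
    max 0 x ∈ floatSet bm be := by
  rcases max_choice 0 x with h | h <;> rw [h]
  exacts [zero_mem_floatSet bm be, hx]

/-- A number whose significand occupies all `bm + 1` bits is a normal floating-point number. -/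
lemma natCast_mul_zpow_mem_floatSet_of_le {bm be m : ℕ} {q : ℤ} (hm : 2 ^ bm ≤ m)
    (hm' : m < 2 ^ (bm + 1)) (hq : Emin be - bm ≤ q) (hq' : q ≤ Emax be - bm) :
    (m : ℝ) * 2 ^ q ∈ floatSet bm be := by
  obtain ⟨t, rfl⟩ := Nat.exists_eq_add_of_le hm
  refine Or.inl ⟨1, t, q + bm, Or.inl rfl, by rw [pow_succ] at hm'; omega, by omega, by omega, ?_⟩
  have h : (2 : ℝ) ^ bm ≠ 0 := by positivity
  rw [zpow_add₀ two_ne_zero, zpow_neg, zpow_natCast]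
  push_cast
  field_simp

lemma natCast_mul_zpow_mem_floatSet {bm be : ℕ} {q : ℤ} (hq : Emin be - bm ≤ q) :
    ∀ {m : ℕ}, m < 2 ^ (bm + 1) → q ≤ Emax be - bm → (m : ℝ) * 2 ^ q ∈ floatSet bm be := by
  induction q, hq using Int.leInduction with
  | base =>
    intro m hm hq
    rcases lt_or_ge m (2 ^ bm) with h | h
    · refine Or.inr ⟨1, m, Or.inl rfl, h, ?_⟩
      rw [sub_eq_add_neg, add_comm, zpow_add₀ two_ne_zero]
      ring
    · exact natCast_mul_zpow_mem_floatSet_of_le h hm le_rfl hq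
  | succ q hq ih =>
    intro m hm hq'
    rcases lt_or_ge m (2 ^ bm) with h | h
    · have := ih (m := 2 * m) (by rw [pow_succ]; omega) (by omega)
      rw [zpow_add_one₀ two_ne_zero]
      convert this using 1
      push_cast
      ring
    · exact natCast_mul_zpow_mem_floatSet_of_le h hm (by omega) hq'

lemma Emin_le_neg_two {be : ℕ} (hbe : 3 ≤ be) : Emin be ≤ -2 := by
  have : (2 : ℤ) ^ 2 ≤ 2 ^ (be - 1) := pow_le_pow_right₀ (by norm_num) (by omega)
  unfold Emin
  linarith

lemma Emax_nonneg (be : ℕ) : 0 ≤ Emax be := by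
  have : (1 : ℤ) ≤ 2 ^ (be - 1) := one_le_pow₀ (by norm_num)
  unfold Emax
  linarith

/-- The integer multiples of the spacing `2 ^ (-1 - bm)` of the floating-point numbers in
`[1 / 2, 1]`. -/
noncomputable def floatGrid (bm : ℕ) : AddSubgroup ℝ :=
  AddSubgroup.zmultiples ((2 : ℝ) ^ (-1 - bm : ℤ))

lemma intCast_mul_zpow_mem_floatGrid {bm : ℕ} (n : ℤ) {q : ℤ} (hq : -1 - bm ≤ q) :
    (n : ℝ) * 2 ^ q ∈ floatGrid bm := by
  obtain ⟨k, rfl⟩ := Int.exists_add_of_le hq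
  refine AddSubgroup.mem_zmultiples_iff.2 ⟨n * 2 ^ k, ?_⟩
  rw [zpow_add₀ two_ne_zero, zsmul_eq_mul, zpow_natCast]
  push_cast
  ring

lemma quarter_mem_floatGrid {bm : ℕ} (hbm : 1 ≤ bm) : (1 / 4 : ℝ) ∈ floatGrid bm := by
  have := intCast_mul_zpow_mem_floatGrid (bm := bm) 1 (q := -2) (by omega)
  norm_num at this ⊢
  exact this

lemma one_mem_floatGrid (bm : ℕ) : (1 : ℝ) ∈ floatGrid bm := by
  simpa using intCast_mul_zpow_mem_floatGrid (bm := bm) 1 (q := 0) (by omega)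

lemma mem_floatSet_of_mem_floatGrid {bm be : ℕ} (hbe : 3 ≤ be) {x : ℝ}
    (hx : x ∈ floatGrid bm) (hx' : |x| ≤ 1) : x ∈ floatSet bm be := by
  have hmin := Emin_le_neg_two hbe
  have hmax := Emax_nonneg be
  suffices h : |x| ∈ floatSet bm be by
    rcases abs_choice x with h' | h' <;> rw [h'] at h
    · exact h
    · simpa using neg_mem_floatSet h
  rcases hx'.eq_or_lt with h | h
  · rw [h]
    have := natCast_mul_zpow_mem_floatSet (bm := bm) (be := be) (q := -bm) (by omega)
      (m := 2 ^ bm) (by rw [pow_succ]; have := Nat.two_pow_pos bm; omega) (by omega)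
    convert this using 1
    rw [zpow_neg, zpow_natCast]
    push_cast
    field_simp
  · obtain ⟨n, rfl⟩ := AddSubgroup.mem_zmultiples_iff.1 hx
    have hpos : (0 : ℝ) < 2 ^ (-1 - bm : ℤ) := by positivity
    have habs : |n • (2 : ℝ) ^ (-1 - bm : ℤ)| = (n.natAbs : ℝ) * 2 ^ (-1 - bm : ℤ) := by
      rw [zsmul_eq_mul, abs_mul, abs_of_pos hpos, Nat.cast_natAbs, Int.cast_abs]
    rw [habs] at h ⊢
    refine natCast_mul_zpow_mem_floatSet (by omega) ?_ (by omega)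
    have hunit : (2 : ℝ) ^ (bm + 1) * 2 ^ (-1 - bm : ℤ) = 1 := by
      rw [← zpow_natCast, ← zpow_add₀ two_ne_zero,
        show ((bm + 1 : ℕ) : ℤ) + (-1 - bm) = 0 by omega, zpow_zero]
    rw [← hunit] at h
    exact_mod_cast lt_of_mul_lt_mul_right h hpos.le

lemma mem_floatGrid_of_mem_floatSet {bm be : ℕ} (hbe : 3 ≤ be) {x : ℝ}
    (hx : x ∈ floatSet bm be) (hx' : 1 / 2 ≤ |x|) : x ∈ floatGrid bm := by
  have hfrac : ∀ t : ℕ, t < 2 ^ bm → (t : ℝ) * 2 ^ (-bm : ℤ) < 1 := by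
    intro t ht
    rw [zpow_neg, zpow_natCast, ← div_eq_mul_inv, div_lt_one (by positivity)]
    exact_mod_cast ht
  have hsign : ∀ ε : ℝ, ε = 1 ∨ ε = -1 → |ε| = 1 := by
    rintro ε (rfl | rfl) <;> simp
  rcases hx with ⟨ε, t, κ, hε, ht, h₁, h₂, rfl⟩ | ⟨ε, t, hε, ht, rfl⟩
  · have hκ : -1 ≤ κ := by
      by_contra! hlt
      have hle : (2 : ℝ) ^ κ ≤ 2 ^ (-2 : ℤ) := zpow_le_zpow_right₀ one_le_two (by omega)
      rw [abs_mul, abs_mul, hsign ε hε, one_mul, abs_of_pos (by positivity),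
        abs_of_pos (by positivity)] at hx'
      have hpos : (0 : ℝ) < 2 ^ κ := by positivity
      norm_num at hle
      nlinarith [hfrac t ht]
    have hmem : ((2 ^ bm + t : ℤ) : ℝ) * 2 ^ (κ - bm) ∈ floatGrid bm := by
      exact_mod_cast intCast_mul_zpow_mem_floatGrid (2 ^ bm + t : ℤ) (by omega)
    have heq : ((2 ^ bm + t : ℤ) : ℝ) * 2 ^ (κ - bm) =
        (1 + (t : ℝ) * 2 ^ (-bm : ℤ)) * 2 ^ κ := by
      rw [zpow_sub₀ two_ne_zero, zpow_neg, zpow_natCast]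
      push_cast
      field_simp
    rw [heq] at hmem
    rcases hε with rfl | rfl
    · rwa [one_mul]
    · rw [neg_one_mul, neg_mul]
      exact neg_mem hmem
  · exfalso
    have hle : (2 : ℝ) ^ Emin be ≤ 2 ^ (-2 : ℤ) :=
      zpow_le_zpow_right₀ one_le_two (Emin_le_neg_two hbe)
    rw [abs_mul, abs_mul, hsign ε hε, one_mul, abs_of_nonneg (by positivity),
      abs_of_pos (by positivity)] at hx'
    have hpos : (0 : ℝ) < 2 ^ Emin be := by positivity
    norm_num at hle
    nlinarith [hfrac t ht]

/-- The MLP that applies the scalar network `t ↦ ∑ k, v k * ReLU (s k * t + c k)` to every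
coordinate. -/
noncomputable def MLP.coordinatewise {n : ℕ} (d : ℕ) (s c v : Fin n → ℝ) : MLP d (n * d) where
  W1 := fun h j => if (finProdFinEquiv.symm h).2 = j then s (finProdFinEquiv.symm h).1 else 0
  b := fun h => c (finProdFinEquiv.symm h).1
  W2 := fun i h => if (finProdFinEquiv.symm h).2 = i then v (finProdFinEquiv.symm h).1 else 0

lemma MLP.coordinatewise_hidden {n d : ℕ} (s c v : Fin n → ℝ) (x : Fin d → ℝ) (k : Fin n)
    (i : Fin d) :
    (MLP.coordinatewise d s c v).hidden x (finProdFinEquiv (k, i)) =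
      max 0 (s k * x i + c k) := by
  simp only [MLP.hidden, MLP.coordinatewise, Matrix.mulVec, dotProduct, Equiv.symm_apply_apply]
  simp

lemma MLP.coordinatewise_W2_mulVec {n d : ℕ} (s c v : Fin n → ℝ) (z : Fin (n * d) → ℝ)
    (i : Fin d) :
    (MLP.coordinatewise d s c v).W2.mulVec z i = ∑ k, v k * z (finProdFinEquiv (k, i)) := by
  simp only [MLP.coordinatewise, Matrix.mulVec, dotProduct]
  rw [← finProdFinEquiv.sum_comp, Fintype.sum_prod_type]
  simp

/-- Input weights of the scalar denoising network. -/
noncomputable def denoiseSlope : Fin 6 → ℝ := ![1, -1, 1, -1, 1, -1]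

/-- Biases of the scalar denoising network. -/
noncomputable def denoiseBias : Fin 6 → ℝ := ![0, 0, -(1 / 4), -(1 / 4), -(3 / 4), -(3 / 4)]

/-- Output weights of the scalar denoising network. -/
noncomputable def denoiseOut : Fin 6 → ℝ := ![-1, 1, 2, -2, -2, 2]

/-- `t` lies within `1 / 4` of the ternary value `a`. -/
def NearTernary (t a : ℝ) : Prop :=
  (a = -1 ∧ t ∈ Set.Icc (-(5 : ℝ) / 4) (-(3 : ℝ) / 4)) ∨
  (a = 0 ∧ t ∈ Set.Icc (-(1 : ℝ) / 4) ((1 : ℝ) / 4)) ∨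
  (a = 1 ∧ t ∈ Set.Icc ((3 : ℝ) / 4) ((5 : ℝ) / 4))

lemma NearTernary.sum_denoise {t a : ℝ} (h : NearTernary t a) :
    ∑ k, denoiseOut k * max 0 (denoiseSlope k * t + denoiseBias k) = a - t := by
  simp only [Fin.sum_univ_six, denoiseOut, denoiseSlope, denoiseBias, Matrix.cons_val]
  rcases h with ⟨rfl, h₁, h₂⟩ | ⟨rfl, h₁, h₂⟩ | ⟨rfl, h₁, h₂⟩
  · rw [max_eq_left (by linarith), max_eq_right (by linarith), max_eq_left (by linarith),
      max_eq_right (by linarith), max_eq_left (by linarith), max_eq_right (by linarith)]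
    ring
  · rcases le_total 0 t with h | h
    · rw [max_eq_right (by linarith), max_eq_left (by linarith), max_eq_left (by linarith),
        max_eq_left (by linarith), max_eq_left (by linarith), max_eq_left (by linarith)]
      ring
    · rw [max_eq_left (by linarith), max_eq_right (by linarith), max_eq_left (by linarith),
        max_eq_left (by linarith), max_eq_left (by linarith), max_eq_left (by linarith)]
      ring
  · rw [max_eq_right (by linarith), max_eq_left (by linarith), max_eq_right (by linarith),
      max_eq_left (by linarith), max_eq_right (by linarith), max_eq_left (by linarith)]
    ring

lemma NearTernary.mem_floatGrid {bm be : ℕ} (hbe : 3 ≤ be) {t a : ℝ} (h : NearTernary t a)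
    (ha : a ≠ 0) (ht : t ∈ floatSet bm be) : t ∈ floatGrid bm := by
  refine mem_floatGrid_of_mem_floatSet hbe ht (le_abs.2 ?_)
  rcases h with ⟨-, h₁, h₂⟩ | ⟨h, -⟩ | ⟨-, h₁, h₂⟩
  · exact Or.inr (by linarith)
  · exact absurd h ha
  · exact Or.inl (by linarith)

lemma NearTernary.relu_sub_mem_floatSet {bm be : ℕ} (hbe : 3 ≤ be) {t a r c : ℝ}
    (h : NearTernary t a) (ht : t ∈ floatSet bm be) (hr : r = t ∨ r = -t)
    (hc : c ∈ floatGrid bm) (hc₁ : 1 / 4 ≤ c) :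
    max 0 (r + -c) ∈ floatSet bm be := by
  rcases le_or_gt (r + -c) 0 with hle | hlt
  · rw [max_eq_left hle]
    exact zero_mem_floatSet bm be
  have hbound : r ≤ 5 / 4 := by
    rcases h with ⟨-, h₁, h₂⟩ | ⟨-, h₁, h₂⟩ | ⟨-, h₁, h₂⟩ <;> rcases hr with rfl | rfl <;> linarith
  have ha : a ≠ 0 := by
    rcases h with ⟨rfl, -⟩ | ⟨rfl, h₁, h₂⟩ | ⟨rfl, -⟩
    · norm_num
    · rcases hr with rfl | rfl <;> linarith
    · norm_num
  have htg := h.mem_floatGrid hbe ha ht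
  have hrg : r ∈ floatGrid bm := by
    rcases hr with rfl | rfl
    exacts [htg, neg_mem htg]
  rw [max_eq_right hlt.le]
  refine mem_floatSet_of_mem_floatGrid hbe (add_mem hrg (neg_mem hc)) ?_
  rw [abs_of_pos hlt]
  linarith

lemma NearTernary.hidden_mem_floatSet {bm be : ℕ} (hbm : 1 ≤ bm) (hbe : 3 ≤ be) {t a : ℝ}
    (h : NearTernary t a) (ht : t ∈ floatSet bm be) (k : Fin 6) :
    max 0 (denoiseSlope k * t + denoiseBias k) ∈ floatSet bm be := by
  have h₁ := quarter_mem_floatGrid hbm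
  have h₃ : (3 / 4 : ℝ) ∈ floatGrid bm := by
    convert sub_mem (one_mem_floatGrid bm) h₁ using 1
    norm_num
  fin_cases k <;> simp only [denoiseSlope, denoiseBias, Fin.reduceFinMk, Fin.zero_eta, Fin.mk_one,
    Matrix.cons_val, one_mul, neg_one_mul, add_zero]
  · exact max_zero_mem_floatSet ht
  · exact max_zero_mem_floatSet (neg_mem_floatSet ht)
  · exact h.relu_sub_mem_floatSet hbe ht (Or.inl rfl) h₁ (by norm_num)
  · exact h.relu_sub_mem_floatSet hbe ht (Or.inr rfl) h₁ (by norm_num)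
  · exact h.relu_sub_mem_floatSet hbe ht (Or.inl rfl) h₃ (by norm_num)
  · exact h.relu_sub_mem_floatSet hbe ht (Or.inr rfl) h₃ (by norm_num)

lemma NearTernary.sub_mem_floatSet {bm be : ℕ} (hbe : 3 ≤ be) {t a : ℝ}
    (h : NearTernary t a) (ht : t ∈ floatSet bm be) : a - t ∈ floatSet bm be := by
  by_cases ha : a = 0
  · simpa [ha] using neg_mem_floatSet ht
  have htg := h.mem_floatGrid hbe ha ht
  have hag : a ∈ floatGrid bm := by
    rcases h with ⟨rfl, -⟩ | ⟨rfl, -⟩ | ⟨rfl, -⟩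
    exacts [neg_mem (one_mem_floatGrid bm), zero_mem _, one_mem_floatGrid bm]
  refine mem_floatSet_of_mem_floatGrid hbe (sub_mem hag htg) (abs_le.2 ?_)
  rcases h with ⟨rfl, h₁, h₂⟩ | ⟨rfl, h₁, h₂⟩ | ⟨rfl, h₁, h₂⟩ <;> constructor <;> linarith

lemma NearTernary.mem_floatSet {bm be : ℕ} (hbe : 3 ≤ be) {t a : ℝ} (h : NearTernary t a) :
    a ∈ floatSet bm be := by
  have h₁ := mem_floatSet_of_mem_floatGrid hbe (one_mem_floatGrid bm) (by simp)
  rcases h with ⟨rfl, -⟩ | ⟨rfl, -⟩ | ⟨rfl, -⟩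
  exacts [neg_mem_floatSet h₁, zero_mem_floatSet bm be, h₁]

/-- Denoising MLP lemma: there exists an MLP `f` with hidden dimension `6d` such that
`y = x + f(x)` satisfies `y_i = -1` on `x_i ∈ [-5/4,-3/4]`, `y_i = 0` on
`x_i ∈ [-1/4,1/4]` and `y_i = 1` on `x_i ∈ [3/4,5/4]`. Moreover, for any `bm ≥ 1` and
`be ≥ 3`, on floating-point inputs the same conclusions hold when the hidden
activations, the output `f(x)`, and the sum `x + f(x)` are each rounded coordinatewise
to `floatSet bm be` (any choice of roundings). -/
theorem denoising_mlp (d : ℕ) :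
    ∃ f : MLP d (6 * d),
      (∀ x : Fin d → ℝ, ∀ i : Fin d,
        (x i ∈ Set.Icc (-(5 : ℝ) / 4) (-(3 : ℝ) / 4) → x i + f.eval x i = -1) ∧
        (x i ∈ Set.Icc (-(1 : ℝ) / 4) ((1 : ℝ) / 4) → x i + f.eval x i = 0) ∧
        (x i ∈ Set.Icc ((3 : ℝ) / 4) ((5 : ℝ) / 4) → x i + f.eval x i = 1)) ∧
      (∀ bm be : ℕ, 1 ≤ bm → 3 ≤ be →
        ∀ x : Fin d → ℝ, (∀ i, x i ∈ floatSet bm be) →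
        ∀ hid : Fin (6 * d) → ℝ,
          (∀ h, IsRounding (floatSet bm be) (f.hidden x h) (hid h)) →
        ∀ out : Fin d → ℝ,
          (∀ i, IsRounding (floatSet bm be) (f.W2.mulVec hid i) (out i)) →
        ∀ y : Fin d → ℝ,
          (∀ i, IsRounding (floatSet bm be) (x i + out i) (y i)) →
        ∀ i : Fin d,
          (x i ∈ Set.Icc (-(5 : ℝ) / 4) (-(3 : ℝ) / 4) → y i = -1) ∧
          (x i ∈ Set.Icc (-(1 : ℝ) / 4) ((1 : ℝ) / 4) → y i = 0) ∧
          (x i ∈ Set.Icc ((3 : ℝ) / 4) ((5 : ℝ) / 4) → y i = 1)) := by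
  refine ⟨MLP.coordinatewise d denoiseSlope denoiseBias denoiseOut, ?_, ?_⟩
  · intro x i
    have key : ∀ a, NearTernary (x i) a →
        x i + (MLP.coordinatewise d denoiseSlope denoiseBias denoiseOut).eval x i = a := by
      intro a h
      simp only [MLP.eval, MLP.coordinatewise_W2_mulVec, MLP.coordinatewise_hidden, h.sum_denoise]
      ring
    exact ⟨fun h => key _ (.inl ⟨rfl, h⟩), fun h => key _ (.inr (.inl ⟨rfl, h⟩)),
      fun h => key _ (.inr (.inr ⟨rfl, h⟩))⟩
  · intro bm be hbm hbe x hx hid hhid out hout y hy i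
    have key : ∀ a, NearTernary (x i) a → y i = a := by
      intro a h
      have hhid' : ∀ k, hid (finProdFinEquiv (k, i)) =
          max 0 (denoiseSlope k * x i + denoiseBias k) := by
        intro k
        have hround := hhid (finProdFinEquiv (k, i))
        rw [MLP.coordinatewise_hidden] at hround
        exact hround.eq_of_mem (h.hidden_mem_floatSet hbm hbe (hx i) k)
      have hround := hout i
      simp only [MLP.coordinatewise_W2_mulVec, hhid', h.sum_denoise] at hround
      have hsum := hy i
      rw [hround.eq_of_mem (h.sub_mem_floatSet hbe (hx i)), add_sub_cancel] at hsum
      exact hsum.eq_of_mem (h.mem_floatSet hbe)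
    exact ⟨fun h => key _ (.inl ⟨rfl, h⟩), fun h => key _ (.inr (.inl ⟨rfl, h⟩)),
      fun h => key _ (.inr (.inr ⟨rfl, h⟩))⟩
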